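/- Let n, m be integers with 1 ≤ n < m. In the field of rational functions ℚ(a,q), define for an integer r the quantum integer [r]_q = q^r − q^{−r} and the quantum factorial [r]_q! = [r]_q [r−1]_q ⋯ [1]_q with [0]_q! = 1. Then Jones' formula for the normalized HOMFLY polynomial of the (n,m) torus knot can be rewritten as follows: (a^{m(n−1)} [1]_q / [n]_q) · Σ_{β=0}^{n−1} (−1)^{n−1−β} q^{−m(2β−n+1)} / ([β]_q! [n−1−β]_q!) · ∏_{j=β−n+1, j≠0}^{β} (q^j a − q^{−j} a^{−1}) = (aq)^{(n−1)(m−1)} · (1 − q^{−2})/(1 − q^{−2n}) · Σ_{β=0}^{n−1} q^{−2mβ} (∏_{i=1}^{β} (a²q^{2i} − 1)/(q^{2i} − 1)) (∏_{j=1}^{n−1−β} (a² − q^{2j})/(1 − q^{2j})), as an identity in ℚ(a,q). -/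

import Mathlib

noncomputable section
open Finset

/-- The field of rational functions `ℚ(a,q)`. -/
abbrev K := FractionRing (MvPolynomial (Fin 2) ℚ)

/-- The indeterminate `a`. -/
def a : K := algebraMap (MvPolynomial (Fin 2) ℚ) K (MvPolynomial.X 0)

/-- The indeterminate `q`. -/
def q : K := algebraMap (MvPolynomial (Fin 2) ℚ) K (MvPolynomial.X 1)

/-- The quantum integer `[r]_q = q^r - q^{-r}`. -/
def qint (r : ℤ) : K := q ^ r - q ^ (-r)

/-- The quantum factorial `[r]_q! = [r]_q [r-1]_q ⋯ [1]_q`, with `[0]_q! = 1`. -/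
def qfact : ℕ → K
  | 0 => 1
  | r + 1 => qint (r + 1) * qfact r

theorem a_ne_zero : a ≠ 0 := by
  simp [a]

theorem q_ne_zero : q ≠ 0 := by
  simp [q]

theorem qint_eq (r : ℤ) : qint r = q ^ (-r) * (q ^ (2 * r) - 1) := by
  rw [qint, mul_sub, ← zpow_add₀ q_ne_zero, mul_one]
  ring_nf

theorem qint_eq' (r : ℤ) : qint r = q ^ r * (1 - q ^ (-(2 * r))) := by
  rw [qint, mul_sub, ← zpow_add₀ q_ne_zero, mul_one]
  ring_nf

theorem prod_Icc_erase_zero {M : Type*} [CommMonoid M] (f : ℤ → M) (b c : ℕ) :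
    ∏ j ∈ (Icc (-(c : ℤ)) (b : ℤ)).erase 0, f j =
      (∏ i ∈ Icc 1 b, f i) * ∏ k ∈ Icc 1 c, f (-k) := by
  induction b with
  | zero =>
    induction c with
    | zero => simp
    | succ c ih =>
      have h : (Icc (-((c + 1 : ℕ) : ℤ)) ((0 : ℕ) : ℤ)).erase 0 =
          insert (-((c + 1 : ℕ) : ℤ)) ((Icc (-(c : ℤ)) ((0 : ℕ) : ℤ)).erase 0) := by
        ext x
        simp only [mem_erase, mem_insert, mem_Icc]
        omega
      rw [h, prod_insert (by simp), ih, prod_Icc_succ_top (by omega)]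
      simp [mul_comm]
  | succ b ih =>
    have h : (Icc (-(c : ℤ)) ((b + 1 : ℕ) : ℤ)).erase 0 =
        insert ((b + 1 : ℕ) : ℤ) ((Icc (-(c : ℤ)) (b : ℤ)).erase 0) := by
      ext x
      simp only [mem_erase, mem_insert, mem_Icc]
      omega
    rw [h, prod_insert (by simp), ih, prod_Icc_succ_top (by omega), ← mul_assoc, mul_comm (f _)]

theorem factor_div_qint (j : ℤ) :
    (q ^ j * a - q ^ (-j) * a⁻¹) / qint j =
      a⁻¹ * ((a ^ 2 * q ^ (2 * j) - 1) / (q ^ (2 * j) - 1)) := by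
  have h : q ^ j * a - q ^ (-j) * a⁻¹ = q ^ (-j) * (a⁻¹ * (a ^ 2 * q ^ (2 * j) - 1)) := by
    have ha := a_ne_zero
    have hq := zpow_ne_zero j q_ne_zero
    rw [two_mul, zpow_add₀ q_ne_zero, zpow_neg]
    field_simp
  rw [h, qint_eq, mul_div_mul_left _ _ (zpow_ne_zero _ q_ne_zero), mul_div_assoc]

theorem neg_factor_div_qint (j : ℤ) :
    -((q ^ (-j) * a - q ^ (- -j) * a⁻¹) / qint j) =
      a⁻¹ * ((a ^ 2 - q ^ (2 * j)) / (1 - q ^ (2 * j))) := by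
  have h : q ^ (-j) * a - q ^ (- -j) * a⁻¹ = q ^ (-j) * (a⁻¹ * (a ^ 2 - q ^ (2 * j))) := by
    have ha := a_ne_zero
    have hq := zpow_ne_zero j q_ne_zero
    rw [neg_neg, two_mul, zpow_add₀ q_ne_zero, zpow_neg]
    field_simp
  rw [h, qint_eq, mul_div_mul_left _ _ (zpow_ne_zero _ q_ne_zero), mul_div_assoc, ← mul_neg,
    ← div_neg, neg_sub]

theorem qfact_eq_prod (b : ℕ) : qfact b = ∏ i ∈ Icc 1 b, qint i := by
  induction b with
  | zero => simp [qfact]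
  | succ b ih => rw [prod_Icc_succ_top (by omega), qfact, ih, mul_comm, Nat.cast_succ]

theorem prod_factor_div_qfact (b : ℕ) :
    (∏ i ∈ Icc 1 b, (q ^ (i : ℤ) * a - q ^ (-(i : ℤ)) * a⁻¹)) / qfact b =
      a⁻¹ ^ b * ∏ i ∈ Icc 1 b, (a ^ 2 * q ^ (2 * (i : ℤ)) - 1) / (q ^ (2 * (i : ℤ)) - 1) := by
  rw [qfact_eq_prod, ← prod_div_distrib]
  simp only [factor_div_qint, prod_mul_distrib, prod_const, Nat.card_Icc, Nat.add_sub_cancel]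

theorem prod_neg_factor_div_qfact (c : ℕ) :
    (-1) ^ c * ((∏ k ∈ Icc 1 c, (q ^ (-(k : ℤ)) * a - q ^ (- -(k : ℤ)) * a⁻¹)) / qfact c) =
      a⁻¹ ^ c * ∏ k ∈ Icc 1 c, (a ^ 2 - q ^ (2 * (k : ℤ))) / (1 - q ^ (2 * (k : ℤ))) := by
  have h : (-1 : K) ^ c = ∏ _k ∈ Icc 1 c, (-1 : K) := by simp
  rw [qfact_eq_prod, ← prod_div_distrib, h, ← prod_mul_distrib]
  simp only [neg_one_mul, neg_factor_div_qint, prod_mul_distrib, prod_const, Nat.card_Icc,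
    Nat.add_sub_cancel]

theorem qint_one_div_qint (n : ℕ) :
    qint 1 / qint n =
      q ^ (1 - (n : ℤ)) * ((1 - q ^ (-2 : ℤ)) / (1 - q ^ (-(2 * (n : ℤ))))) := by
  rw [qint_eq', qint_eq', mul_div_mul_comm, ← zpow_sub₀ q_ne_zero]
  norm_num

theorem jones_summand (m b c : ℕ) :
    (-1 : K) ^ c * q ^ (-((m : ℤ) * ((b : ℤ) - c))) / (qfact b * qfact c) *
        ∏ j ∈ (Icc (-(c : ℤ)) (b : ℤ)).erase 0, (q ^ j * a - q ^ (-j) * a⁻¹) =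
      a⁻¹ ^ (b + c) * q ^ ((m : ℤ) * (b + c)) * (q ^ (-(2 * (m : ℤ) * b)) *
        (∏ i ∈ Icc 1 b, (a ^ 2 * q ^ (2 * (i : ℤ)) - 1) / (q ^ (2 * (i : ℤ)) - 1)) *
        (∏ j ∈ Icc 1 c, (a ^ 2 - q ^ (2 * (j : ℤ))) / (1 - q ^ (2 * (j : ℤ))))) := by
  have hq : q ^ (-((m : ℤ) * ((b : ℤ) - c))) =
      q ^ ((m : ℤ) * (b + c)) * q ^ (-(2 * (m : ℤ) * b)) := by
    rw [← zpow_add₀ q_ne_zero]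
    ring_nf
  rw [prod_Icc_erase_zero, hq]
  have hb := prod_factor_div_qfact b
  have hc := prod_neg_factor_div_qfact c
  rw [pow_add]
  linear_combination q ^ ((m : ℤ) * (b + c)) * q ^ (-(2 * (m : ℤ) * b)) *
    (((-1) ^ c * ((∏ k ∈ Icc 1 c, (q ^ (-(k : ℤ)) * a - q ^ (- -(k : ℤ)) * a⁻¹)) / qfact c)) * hb +
      a⁻¹ ^ b * (∏ i ∈ Icc 1 b, (a ^ 2 * q ^ (2 * (i : ℤ)) - 1) / (q ^ (2 * (i : ℤ)) - 1)) * hc)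

/-- Jones' formula for the normalized HOMFLY polynomial of the
`(n,m)` torus knot can be rewritten as stated, as an identity in `ℚ(a,q)`. -/
theorem statement_0 (n m : ℕ) (hn : 1 ≤ n) (hnm : n < m) :
    a ^ (m * (n - 1)) * qint 1 / qint n *
      ∑ β ∈ range n, (-1 : K) ^ (n - 1 - β) *
        q ^ (-((m : ℤ) * (2 * (β : ℤ) - n + 1))) / (qfact β * qfact (n - 1 - β)) *
        ∏ j ∈ (Icc ((β : ℤ) - n + 1) (β : ℤ)).erase 0,
          (q ^ j * a - q ^ (-j) * a⁻¹)
    = (a * q) ^ ((n - 1) * (m - 1)) *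
        ((1 - q ^ (-2 : ℤ)) / (1 - q ^ (-(2 * (n : ℤ))))) *
      ∑ β ∈ range n, q ^ (-(2 * (m : ℤ) * β)) *
        (∏ i ∈ Icc 1 β, (a ^ 2 * q ^ (2 * (i : ℤ)) - 1) / (q ^ (2 * (i : ℤ)) - 1)) *
        (∏ j ∈ Icc 1 (n - 1 - β), (a ^ 2 - q ^ (2 * (j : ℤ))) / (1 - q ^ (2 * (j : ℤ)))) := by
  obtain ⟨N, rfl⟩ : ∃ N, n = N + 1 := ⟨n - 1, by omega⟩
  obtain ⟨M, rfl⟩ : ∃ M, m = M + 1 := ⟨m - 1, by omega⟩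
  simp only [Nat.add_sub_cancel]
  have hsum : ∀ β ∈ range (N + 1), (-1 : K) ^ (N - β) *
        q ^ (-(((M + 1 : ℕ) : ℤ) * (2 * (β : ℤ) - (N + 1 : ℕ) + 1))) /
          (qfact β * qfact (N - β)) *
        ∏ j ∈ (Icc ((β : ℤ) - (N + 1 : ℕ) + 1) (β : ℤ)).erase 0, (q ^ j * a - q ^ (-j) * a⁻¹) =
      a⁻¹ ^ N * q ^ (((M + 1 : ℕ) : ℤ) * N) * (q ^ (-(2 * ((M + 1 : ℕ) : ℤ) * β)) *
        (∏ i ∈ Icc 1 β, (a ^ 2 * q ^ (2 * (i : ℤ)) - 1) / (q ^ (2 * (i : ℤ)) - 1)) *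
        (∏ j ∈ Icc 1 (N - β), (a ^ 2 - q ^ (2 * (j : ℤ))) / (1 - q ^ (2 * (j : ℤ))))) := by
    intro β hβ
    obtain ⟨c, rfl⟩ := Nat.exists_eq_add_of_le (Nat.lt_succ_iff.mp (mem_range.mp hβ))
    have h₁ : 2 * (β : ℤ) - (β + c + 1 : ℕ) + 1 = β - c := by push_cast; ring
    have h₂ : (β : ℤ) - (β + c + 1 : ℕ) + 1 = -c := by push_cast; ring
    rw [Nat.add_sub_cancel_left, h₁, h₂, jones_summand, Nat.cast_add β c]
  rw [sum_congr rfl hsum, ← mul_sum, mul_div_assoc, qint_one_div_qint, ← mul_assoc]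
  congr 1
  have ha : a ^ ((M + 1) * N) * a⁻¹ ^ N = a ^ (N * M) := by
    rw [show (M + 1) * N = N * M + N by ring, pow_add, mul_assoc, ← mul_pow,
      mul_inv_cancel₀ a_ne_zero, one_pow, mul_one]
  have hq : q ^ (1 - ((N + 1 : ℕ) : ℤ)) * q ^ (((M + 1 : ℕ) : ℤ) * N) = q ^ (N * M) := by
    rw [← zpow_add₀ q_ne_zero, ← zpow_natCast]
    push_cast
    ring_nf
  rw [mul_pow, ← ha, ← hq]
  ring
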